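/- Let Λ be a finitely aligned k-graph and let 𝓔 ⊆ FE(Λ) be satiated. The collection {S_𝓔(λ) : λ ∈ Λ} of bounded operators on ℓ²(∂(Λ;𝓔)) is a relative Cuntz-Krieger (Λ;𝓔)-family; that is, it satisfies (TCK1), (TCK2), (TCK3) and (CK). -/

import Mathlib

open scoped ENNReal

attribute [local instance] Classical.propDecidable

/-- Product of `f` over a set `S`, in some arbitrary order (junk value `1` if `S` is
infinite).  Used for products of commuting projections. -/
noncomputable def listProd {ι A : Type*} [Monoid A] (S : Set ι) (f : ι → A) : A :=
  if h : S.Finite then (h.toFinset.toList.map f).prod else 1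

/-- A `k`-graph: a countable category `Λ` (whose morphisms are the terms of `Path`, with
vertices identified with the morphisms of degree `0`) together with a degree functor
`d : Λ → ℕ^k` satisfying the factorisation property. -/
structure KGraph (k : ℕ) where
  Path : Type
  countable : Countable Path
  d : Path → Fin k → ℕ
  r : Path → Path
  s : Path → Path
  comp : Path → Path → Path
  d_r : ∀ lam, d (r lam) = 0
  d_s : ∀ lam, d (s lam) = 0
  r_r : ∀ lam, r (r lam) = r lam
  s_r : ∀ lam, s (r lam) = r lam
  r_s : ∀ lam, r (s lam) = s lam
  s_s : ∀ lam, s (s lam) = s lam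
  comp_source : ∀ lam, comp lam (s lam) = lam
  range_comp : ∀ lam, comp (r lam) lam = lam
  r_comp : ∀ lam mu, s lam = r mu → r (comp lam mu) = r lam
  s_comp : ∀ lam mu, s lam = r mu → s (comp lam mu) = s mu
  d_comp : ∀ lam mu, s lam = r mu → d (comp lam mu) = d lam + d mu
  comp_assoc : ∀ lam mu nu, s lam = r mu → s mu = r nu →
    comp (comp lam mu) nu = comp lam (comp mu nu)
  factor : ∀ lam m n, d lam = m + n →
    ∃! p : Path × Path, s p.1 = r p.2 ∧ d p.1 = m ∧ d p.2 = n ∧ comp p.1 p.2 = lam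

namespace KGraph

variable {k : ℕ} (Λ : KGraph k)

/-- Vertices are identified with the paths of degree `0`. -/
def IsVertex (v : Λ.Path) : Prop := Λ.d v = 0

/-- The unique factorisation of `lam` as a product of a path of degree `m` and the
remaining tail (junk value if `¬ m ≤ d lam`). -/
noncomputable def split (lam : Λ.Path) (m : Fin k → ℕ) : Λ.Path × Λ.Path :=
  if h : m ≤ Λ.d lam then
    (Λ.factor lam m (Λ.d lam - m) (by
      funext i
      exact (Nat.add_sub_cancel' (h i)).symm)).choose
  else (lam, lam)

/-- The segment `λ(m,n)` of the path `λ`: the unique path of degree `n - m` such that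
`λ = λ(0,m) λ(m,n) λ(n, d λ)` (meaningful for `m ≤ n ≤ d λ`). -/
noncomputable def seg (lam : Λ.Path) (m n : Fin k → ℕ) : Λ.Path :=
  (Λ.split (Λ.split lam n).1 m).2

/-- `MCE(μ,ν)`: minimal common extensions of `μ` and `ν`. -/
def MCE (mu nu : Λ.Path) : Set Λ.Path :=
  {lam | Λ.d lam = Λ.d mu ⊔ Λ.d nu ∧ Λ.seg lam 0 (Λ.d mu) = mu ∧ Λ.seg lam 0 (Λ.d nu) = nu}

/-- `Λ^min(μ,ν) = {(α,β) : μα = νβ ∈ MCE(μ,ν)}`. -/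
def Lmin (mu nu : Λ.Path) : Set (Λ.Path × Λ.Path) :=
  {p | Λ.s mu = Λ.r p.1 ∧ Λ.s nu = Λ.r p.2 ∧ Λ.comp mu p.1 = Λ.comp nu p.2 ∧
    Λ.comp mu p.1 ∈ Λ.MCE mu nu}

/-- `Ext(μ;E)`: extensions of `μ` with respect to `E`. -/
def Ext (mu : Λ.Path) (E : Set Λ.Path) : Set Λ.Path :=
  {a | Λ.r a = Λ.s mu ∧ ∃ nu ∈ E, ∃ b, (a, b) ∈ Λ.Lmin mu nu}

/-- `Λ` is finitely aligned if all the sets `MCE(μ,ν)` are finite. -/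
def FinitelyAligned : Prop := ∀ mu nu, (Λ.MCE mu nu).Finite

/-- `E ⊆ vΛ` is exhaustive if `Ext(λ;E) ≠ ∅` for all `λ ∈ vΛ`. -/
def Exhaustive (v : Λ.Path) (E : Set Λ.Path) : Prop :=
  ∀ lam, Λ.r lam = v → (Λ.Ext lam E).Nonempty

/-- `E ∈ vFE(Λ)`: `E ⊆ vΛ \ {v}` is finite and exhaustive (so `r(E) = v`). -/
def FEat (v : Λ.Path) (E : Set Λ.Path) : Prop :=
  Λ.IsVertex v ∧ (∀ lam ∈ E, Λ.r lam = v ∧ lam ≠ v) ∧ E.Finite ∧ Λ.Exhaustive v E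

/-- `FE(Λ)`: the finite exhaustive sets. -/
def FE : Set (Set Λ.Path) := {E | ∃ v, Λ.FEat v E}

/-- `λE = {λμ : μ ∈ E, r(μ) = s(λ)}`. -/
def lamSet (lam : Λ.Path) (E : Set Λ.Path) : Set Λ.Path :=
  {x | ∃ mu ∈ E, Λ.s lam = Λ.r mu ∧ Λ.comp lam mu = x}

/-- `EΛ = {λμ : λ ∈ E, r(μ) = s(λ)}`. -/
def setLam (E : Set Λ.Path) : Set Λ.Path :=
  {x | ∃ lam ∈ E, ∃ mu, Λ.s lam = Λ.r mu ∧ Λ.comp lam mu = x}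

/-- `𝓔 ⊆ FE(Λ)` is satiated if it satisfies (S1)--(S4). -/
def Satiated (𝓔 : Set (Set Λ.Path)) : Prop :=
  𝓔 ⊆ Λ.FE ∧
  (∀ G ∈ 𝓔, ∀ E ∈ Λ.FE, G ⊆ E → E ∈ 𝓔) ∧
  (∀ G ∈ 𝓔, ∀ v, Λ.FEat v G → ∀ mu, Λ.r mu = v → mu ∉ Λ.setLam G → Λ.Ext mu G ∈ 𝓔) ∧
  (∀ G ∈ 𝓔, ∀ n : Λ.Path → Fin k → ℕ, (∀ lam ∈ G, 0 < n lam ∧ n lam ≤ Λ.d lam) →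
    ((fun lam => Λ.seg lam 0 (n lam)) '' G) ∈ 𝓔) ∧
  (∀ G ∈ 𝓔, ∀ G' ⊆ G, ∀ Gl : Λ.Path → Set Λ.Path,
    (∀ lam ∈ G', Gl lam ∈ 𝓔 ∧ Λ.FEat (Λ.s lam) (Gl lam)) →
    ((G \ G') ∪ ⋃ lam ∈ G', Λ.lamSet lam (Gl lam)) ∈ 𝓔)

/-- The satiation `𝓔̄` of `𝓔`: the smallest satiated subset of `FE(Λ)` containing `𝓔`. -/
def satiation (𝓔 : Set (Set Λ.Path)) : Set (Set Λ.Path) :=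
  ⋂₀ {F | 𝓔 ⊆ F ∧ Λ.Satiated F}

/-- `ΠE`: the smallest subset of `Λ` containing `E` which is closed under the operation
`(λ,μ,σ) ↦ λ Ext(μ;{σ})` for `λ,μ,σ ∈ ΠE` with `d(λ) = d(μ)`, `s(λ) = s(μ)`. -/
def PiSet (E : Set Λ.Path) : Set Λ.Path :=
  ⋂₀ {G | E ⊆ G ∧ ∀ lam mu sig, lam ∈ G → mu ∈ G → sig ∈ G →
    Λ.d lam = Λ.d mu → Λ.s lam = Λ.s mu → Λ.lamSet lam (Λ.Ext mu {sig}) ⊆ G}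

/-- `Σ₁(𝓔)`: finite sets `F ⊆ r(E)Λ \ Λ⁰` containing some `E ∈ 𝓔`. -/
def Sig1 (𝓔 : Set (Set Λ.Path)) : Set (Set Λ.Path) :=
  {F | ∃ E ∈ 𝓔, ∃ v, Λ.FEat v E ∧ E ⊆ F ∧ F.Finite ∧
    ∀ lam ∈ F, Λ.r lam = v ∧ ¬ Λ.IsVertex lam}

/-- `Σ₂(𝓔) = {Ext(μ;E) : E ∈ 𝓔, μ ∈ r(E)Λ \ EΛ}`. -/
def Sig2 (𝓔 : Set (Set Λ.Path)) : Set (Set Λ.Path) :=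
  {F | ∃ E ∈ 𝓔, ∃ v, Λ.FEat v E ∧ ∃ mu, Λ.r mu = v ∧ mu ∉ Λ.setLam E ∧ F = Λ.Ext mu E}

/-- `Σ₃(𝓔) = {{λ(0,n_λ) : λ ∈ E} : E ∈ 𝓔, 0 < n_λ ≤ d(λ)}`. -/
def Sig3 (𝓔 : Set (Set Λ.Path)) : Set (Set Λ.Path) :=
  {F | ∃ E ∈ 𝓔, ∃ n : Λ.Path → Fin k → ℕ, (∀ lam ∈ E, 0 < n lam ∧ n lam ≤ Λ.d lam) ∧
    F = (fun lam => Λ.seg lam 0 (n lam)) '' E}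

/-- `Σ₄(𝓔) = {(E \ F) ∪ ⋃_{λ ∈ F} λ F_λ : E ∈ 𝓔, F ⊆ E, F_λ ∈ s(λ)𝓔}`. -/
def Sig4 (𝓔 : Set (Set Λ.Path)) : Set (Set Λ.Path) :=
  {G | ∃ E ∈ 𝓔, ∃ F ⊆ E, ∃ Fl : Λ.Path → Set Λ.Path,
    (∀ lam ∈ F, Fl lam ∈ 𝓔 ∧ Λ.FEat (Λ.s lam) (Fl lam)) ∧
    G = (E \ F) ∪ ⋃ lam ∈ F, Λ.lamSet lam (Fl lam)}

/-- `Σ = Σ₄ ∘ Σ₃ ∘ Σ₂ ∘ Σ₁`. -/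
def SigmaStep (𝓔 : Set (Set Λ.Path)) : Set (Set Λ.Path) :=
  Λ.Sig4 (Λ.Sig3 (Λ.Sig2 (Λ.Sig1 𝓔)))

/-- `Σ^∞(𝓔) = ⋃_{n ≥ 1} Σ^n(𝓔)`. -/
def SigmaInf (𝓔 : Set (Set Λ.Path)) : Set (Set Λ.Path) :=
  ⋃ n : ℕ, (Λ.SigmaStep)^[n + 1] 𝓔

section StarAlgebra

variable {A : Type*} [Ring A] [StarRing A]

/-- The product `∏_{λ ∈ E} (t_v - t_λ t_λ*)` (the factors pairwise commute for any
family satisfying (TCK1)--(TCK3), so the implicit choice of ordering is immaterial). -/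
noncomputable def gapProd (t : Λ.Path → A) (v : Λ.Path) (E : Set Λ.Path) : A :=
  listProd E fun lam => t v - t lam * star (t lam)

/-- Conditions (TCK1)--(TCK3) on a family `{t_λ}`. -/
def TCKFamily (t : Λ.Path → A) : Prop :=
  (∀ v, Λ.IsVertex v → star (t v) = t v ∧ t v * t v = t v) ∧
  (∀ v w, Λ.IsVertex v → Λ.IsVertex w → v ≠ w → t v * t w = 0) ∧
  (∀ lam mu, Λ.s lam = Λ.r mu → t lam * t mu = t (Λ.comp lam mu)) ∧
  (∀ lam mu, star (t lam) * t mu = ∑ᶠ p ∈ Λ.Lmin lam mu, t p.1 * star (t p.2))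

/-- A relative Cuntz-Krieger `(Λ;𝓔)`-family: (TCK1)--(TCK3) together with (CK). -/
def RCKFamily (𝓔 : Set (Set Λ.Path)) (t : Λ.Path → A) : Prop :=
  Λ.TCKFamily t ∧ ∀ E ∈ 𝓔, ∀ v, Λ.FEat v E → Λ.gapProd t v E = 0

/-- `Θ(t)^{ΠE}_{λ,μ} = t_λ (∏_{λν ∈ ΠE, d(ν) > 0} (t_{s(λ)} - t_ν t_ν*)) t_μ*`. -/
noncomputable def Theta (t : Λ.Path → A) (E : Set Λ.Path) (lam mu : Λ.Path) : A :=
  t lam *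
    listProd {nu | Λ.s lam = Λ.r nu ∧ ¬ Λ.IsVertex nu ∧ Λ.comp lam nu ∈ Λ.PiSet E}
      (fun nu => t (Λ.s lam) - t nu * star (t nu)) *
    star (t mu)

end StarAlgebra

end KGraph

/-- A graph morphism `x : Ω_{k,m} → Λ`, encoded by its length `m = d(x) ∈ (ℕ∪{∞})^k`
and its values `x(p,q)` on the morphisms `(p,q)` of `Ω_{k,m}` (with the junk value
`x(0,0)` outside the meaningful domain, so graph morphisms are extensional). -/
structure GMor {k : ℕ} (Λ : KGraph k) where
  len : Fin k → ℕ∞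
  seg : (Fin k → ℕ) → (Fin k → ℕ) → Λ.Path
  d_seg : ∀ p q, p ≤ q → (∀ i, (q i : ℕ∞) ≤ len i) → Λ.d (seg p q) = q - p
  r_seg : ∀ p q, p ≤ q → (∀ i, (q i : ℕ∞) ≤ len i) → Λ.r (seg p q) = seg p p
  s_seg : ∀ p q, p ≤ q → (∀ i, (q i : ℕ∞) ≤ len i) → Λ.s (seg p q) = seg q q
  comp_seg : ∀ p q u, p ≤ q → q ≤ u → (∀ i, (u i : ℕ∞) ≤ len i) →
    Λ.comp (seg p q) (seg q u) = seg p u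
  seg_junk : ∀ p q, ¬ (p ≤ q ∧ ∀ i, (q i : ℕ∞) ≤ len i) → seg p q = seg 0 0

namespace GMor

variable {k : ℕ} {Λ : KGraph k}

/-- The range `r(x) = x(0)` of a graph morphism. -/
def range (x : GMor Λ) : Λ.Path := x.seg 0 0

/-- `y = x|_n^{d(x)}`, the restriction of `x` (defined for `n ≤ d(x)`):
`d(y) = d(x) - n` and `y(p,q) = x(n+p, n+q)`. -/
def IsRestriction (y x : GMor Λ) (n : Fin k → ℕ) : Prop :=
  (∀ i, y.len i = x.len i - (n i : ℕ∞)) ∧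
  ∀ p q, p ≤ q → (∀ i, (q i : ℕ∞) ≤ y.len i) → y.seg p q = x.seg (n + p) (n + q)

/-- `y = λx`, the extension of `x` by `λ ∈ Λ r(x)`: `d(y) = d(λ) + d(x)`,
`y(0, d(λ)) = λ` and `y(d(λ), d(λ)+n) = x(0,n)` for `n ≤ d(x)`. -/
def IsExtension (y : GMor Λ) (lam : Λ.Path) (x : GMor Λ) : Prop :=
  (∀ i, y.len i = (Λ.d lam i : ℕ∞) + x.len i) ∧
  y.seg 0 (Λ.d lam) = lam ∧
  ∀ n : Fin k → ℕ, (∀ i, (n i : ℕ∞) ≤ x.len i) →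
    y.seg (Λ.d lam) (Λ.d lam + n) = x.seg 0 n

/-- `x ∈ FΛ^∞`: `x` has an initial segment belonging to `F`. -/
def HasInit (x : GMor Λ) (F : Set Λ.Path) : Prop :=
  ∃ lam ∈ F, (∀ i, (Λ.d lam i : ℕ∞) ≤ x.len i) ∧ x.seg 0 (Λ.d lam) = lam

/-- `z` restricts to `x` on `Ω_{k, d(x)}`. -/
def Agrees (z x : GMor Λ) : Prop :=
  ∀ p q, p ≤ q → (∀ i, (q i : ℕ∞) ≤ x.len i) → z.seg p q = x.seg p q

/-- `z ∈ MCE(x,y)` for graph morphisms `x, y`. -/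
def IsMCE (z x y : GMor Λ) : Prop :=
  (∀ i, z.len i = max (x.len i) (y.len i)) ∧ z.Agrees x ∧ z.Agrees y

/-- `x` is aperiodic: for distinct `λ, μ ∈ Λ r(x)`, `MCE(λx, μx) = ∅`. -/
def Aperiodic (x : GMor Λ) : Prop :=
  ∀ lam mu : Λ.Path, lam ≠ mu → Λ.s lam = x.range → Λ.s mu = x.range →
    ∀ lx mx : GMor Λ, lx.IsExtension lam x → mx.IsExtension mu x →
      ∀ z : GMor Λ, ¬ z.IsMCE lx mx

end GMor

namespace KGraph

variable {k : ℕ} (Λ : KGraph k)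

/-- `x ∈ ∂(Λ;𝓔)`: an `𝓔`-compatible boundary path. -/
def IsBdry (𝓔 : Set (Set Λ.Path)) (x : GMor Λ) : Prop :=
  ∀ n : Fin k → ℕ, (∀ i, (n i : ℕ∞) ≤ x.len i) →
    ∀ E ∈ 𝓔, Λ.FEat (x.seg n n) E →
      ∃ lam ∈ E, (∀ i, ((n + Λ.d lam) i : ℕ∞) ≤ x.len i) ∧ x.seg n (n + Λ.d lam) = lam

/-- Condition (C): aperiodic `𝓔`-compatible boundary paths out of every vertex, and
avoiding any given `F ∈ vFE(Λ) \ 𝓔`. -/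
def CondC (𝓔 : Set (Set Λ.Path)) : Prop :=
  (∀ v, Λ.IsVertex v → ∃ x : GMor Λ, Λ.IsBdry 𝓔 x ∧ x.range = v ∧ x.Aperiodic) ∧
  (∀ v F, Λ.FEat v F → F ∉ 𝓔 →
    ∃ x : GMor Λ, Λ.IsBdry 𝓔 x ∧ x.range = v ∧ ¬ x.HasInit F ∧ x.Aperiodic)

end KGraph

namespace KGraph

variable {k : ℕ} {Λ : KGraph k}

lemma cancel {a b a' b' : Λ.Path} (h : Λ.s a = Λ.r b) (h' : Λ.s a' = Λ.r b')
    (hd : Λ.d a = Λ.d a') (hc : Λ.comp a b = Λ.comp a' b') : a = a' ∧ b = b' := by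
  have hb : Λ.d b = Λ.d b' := by
    have h1 := Λ.d_comp a b h
    rw [hc, Λ.d_comp a' b' h', hd] at h1
    exact (add_left_cancel h1).symm
  have h2 := (Λ.factor (Λ.comp a b) (Λ.d a) (Λ.d b) (Λ.d_comp a b h)).unique
    (y₁ := (a, b)) (y₂ := (a', b')) ⟨h, rfl, rfl, rfl⟩ ⟨h', hd.symm, hb.symm, hc.symm⟩
  exact Prod.ext_iff.1 h2

lemma IsVertex.r_eq {v : Λ.Path} (hv : Λ.IsVertex v) : Λ.r v = v := by
  have h := cancel (a := Λ.r v) (b := v) (a' := v) (b' := Λ.s v) (Λ.s_r v) (Λ.r_s v).symm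
    ((Λ.d_r v).trans hv.symm) ((Λ.range_comp v).trans (Λ.comp_source v).symm)
  exact h.1

lemma IsVertex.s_eq {v : Λ.Path} (hv : Λ.IsVertex v) : Λ.s v = v := by
  have h := cancel (a := Λ.r v) (b := v) (a' := v) (b' := Λ.s v) (Λ.s_r v) (Λ.r_s v).symm
    ((Λ.d_r v).trans hv.symm) ((Λ.range_comp v).trans (Λ.comp_source v).symm)
  exact h.2.symm

lemma split_spec {lam : Λ.Path} {m : Fin k → ℕ} (h : m ≤ Λ.d lam) :
    Λ.s (Λ.split lam m).1 = Λ.r (Λ.split lam m).2 ∧ Λ.d (Λ.split lam m).1 = m ∧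
      Λ.d (Λ.split lam m).2 = Λ.d lam - m ∧
      Λ.comp (Λ.split lam m).1 (Λ.split lam m).2 = lam := by
  unfold split
  rw [dif_pos h]
  exact (Λ.factor lam m (Λ.d lam - m) (add_tsub_cancel_of_le h).symm).choose_spec.1

lemma split_comp {a b : Λ.Path} (h : Λ.s a = Λ.r b) :
    Λ.split (Λ.comp a b) (Λ.d a) = (a, b) := by
  have hle : Λ.d a ≤ Λ.d (Λ.comp a b) := by rw [Λ.d_comp a b h]; exact le_self_add
  obtain ⟨h1, h2, -, h4⟩ := split_spec hle
  exact Prod.ext_iff.2 (cancel h1 h h2 h4)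

lemma seg_zero (lam : Λ.Path) (n : Fin k → ℕ) :
    Λ.seg lam 0 n = (Λ.split lam n).1 := by
  obtain ⟨h1, h2, -, h4⟩ := split_spec (lam := (Λ.split lam n).1) (m := 0) zero_le
  have hr : (Λ.split (Λ.split lam n).1 0).1 = Λ.r (Λ.split (Λ.split lam n).1 0).2 := by
    rw [← h1, IsVertex.s_eq h2]
  rw [hr, Λ.range_comp] at h4
  exact h4

lemma seg_zero_comp {a b : Λ.Path} (h : Λ.s a = Λ.r b) :
    Λ.seg (Λ.comp a b) 0 (Λ.d a) = a := by
  rw [seg_zero, split_comp h]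

lemma mem_Lmin {mu nu : Λ.Path} {p : Λ.Path × Λ.Path} :
    p ∈ Λ.Lmin mu nu ↔ Λ.s mu = Λ.r p.1 ∧ Λ.s nu = Λ.r p.2 ∧
      Λ.comp mu p.1 = Λ.comp nu p.2 ∧ Λ.d mu + Λ.d p.1 = Λ.d mu ⊔ Λ.d nu := by
  refine and_congr_right fun h1 => and_congr_right fun h2 => and_congr_right fun h3 => ?_
  rw [← Λ.d_comp _ _ h1]
  refine ⟨fun h => h.1, fun h => ⟨h, seg_zero_comp h1, ?_⟩⟩
  rw [h3]
  exact seg_zero_comp h2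

lemma finite_Lmin (hΛ : Λ.FinitelyAligned) (mu nu : Λ.Path) : (Λ.Lmin mu nu).Finite := by
  refine Set.Finite.of_finite_image (f := fun p => Λ.comp mu p.1)
    ((hΛ mu nu).subset ?_) ?_
  · rintro _ ⟨p, hp, rfl⟩
    exact hp.2.2.2
  · intro p hp q hq h
    have h1 : p.1 = q.1 := (cancel hp.1 hq.1 rfl h).2
    refine Prod.ext h1 (cancel hp.2.1 hq.2.1 rfl ?_).2
    rw [← hp.2.2.1, ← hq.2.2.1, h1]

/-- `a` is an initial segment of `b`. -/
def IsPrefix (a b : Λ.Path) : Prop := ∃ c, Λ.s a = Λ.r c ∧ Λ.comp a c = b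

lemma isPrefix_seg_zero {lam : Λ.Path} {n : Fin k → ℕ} (h : n ≤ Λ.d lam) :
    IsPrefix (Λ.seg lam 0 n) lam := by
  rw [seg_zero]
  exact ⟨_, (split_spec h).1, (split_spec h).2.2.2⟩

lemma IsPrefix.trans {a b c : Λ.Path} (hab : IsPrefix a b) (hbc : IsPrefix b c) :
    IsPrefix a c := by
  obtain ⟨u, hu, rfl⟩ := hab
  obtain ⟨w, hw, rfl⟩ := hbc
  rw [Λ.s_comp _ _ hu] at hw
  exact ⟨Λ.comp u w, by rw [Λ.r_comp _ _ hw, hu], (Λ.comp_assoc _ _ _ hu hw).symm⟩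

lemma IsPrefix.eq_of_d_eq {a b c : Λ.Path} (ha : IsPrefix a c) (hb : IsPrefix b c)
    (hd : Λ.d a = Λ.d b) : a = b := by
  obtain ⟨u, hu, rfl⟩ := ha
  obtain ⟨w, hw, h⟩ := hb
  exact (cancel hu hw hd h.symm).1

lemma IsPrefix.of_d_le {a b c : Λ.Path} (ha : IsPrefix a c) (hb : IsPrefix b c)
    (hd : Λ.d a ≤ Λ.d b) : IsPrefix a b := by
  have h := isPrefix_seg_zero hd
  have h' : Λ.d (Λ.seg b 0 (Λ.d a)) = Λ.d a := by
    rw [seg_zero]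
    exact (split_spec hd).2.1
  rwa [ha.eq_of_d_eq (h.trans hb) h'.symm]

lemma IsPrefix.comp_left {a b c : Λ.Path} (hab : IsPrefix a b) (hc : Λ.s c = Λ.r a) :
    IsPrefix (Λ.comp c a) (Λ.comp c b) := by
  obtain ⟨u, hu, rfl⟩ := hab
  exact ⟨u, by rw [Λ.s_comp _ _ hc, hu], Λ.comp_assoc _ _ _ hc hu⟩

end KGraph

namespace GMor

open KGraph

variable {k : ℕ} {Λ : KGraph k}

lemma le_len_of_le (x : GMor Λ) {p q : Fin k → ℕ} (h : p ≤ q)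
    (hq : ∀ i, (q i : ℕ∞) ≤ x.len i) (i : Fin k) : (p i : ℕ∞) ≤ x.len i :=
  (Nat.cast_le.2 (h i)).trans (hq i)

lemma d_init (x : GMor Λ) {q : Fin k → ℕ} (hq : ∀ i, (q i : ℕ∞) ≤ x.len i) :
    Λ.d (x.seg 0 q) = q := by
  rw [x.d_seg 0 q zero_le hq, tsub_zero]

lemma r_init (x : GMor Λ) {q : Fin k → ℕ} (hq : ∀ i, (q i : ℕ∞) ≤ x.len i) :
    Λ.r (x.seg 0 q) = x.range :=
  x.r_seg 0 q zero_le hq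

lemma s_seg_eq_r_seg (x : GMor Λ) {p q u : Fin k → ℕ} (hpq : p ≤ q) (hqu : q ≤ u)
    (hu : ∀ i, (u i : ℕ∞) ≤ x.len i) : Λ.s (x.seg p q) = Λ.r (x.seg q u) := by
  rw [x.s_seg p q hpq (x.le_len_of_le hqu hu), x.r_seg q u hqu hu]

lemma isPrefix_init (x : GMor Λ) {p q : Fin k → ℕ} (hpq : p ≤ q)
    (hq : ∀ i, (q i : ℕ∞) ≤ x.len i) : IsPrefix (x.seg 0 p) (x.seg 0 q) :=
  ⟨x.seg p q, x.s_seg_eq_r_seg zero_le hpq hq, x.comp_seg 0 p q zero_le hpq hq⟩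

/-- A graph morphism is determined by its length and its initial segments. -/
lemma ext_init {x y : GMor Λ} (hlen : ∀ i, x.len i = y.len i)
    (hinit : ∀ q : Fin k → ℕ, (∀ i, (q i : ℕ∞) ≤ x.len i) → x.seg 0 q = y.seg 0 q) :
    x = y := by
  have hl : x.len = y.len := funext hlen
  have hs : x.seg = y.seg := by
    funext p q
    by_cases h : p ≤ q ∧ ∀ i, (q i : ℕ∞) ≤ x.len i
    · obtain ⟨hpq, hq⟩ := h
      have hq' : ∀ i, (q i : ℕ∞) ≤ y.len i := hl ▸ hq
      refine (cancel (x.s_seg_eq_r_seg zero_le hpq hq)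
        (y.s_seg_eq_r_seg zero_le hpq hq') ?_ ?_).2
      · rw [hinit p (x.le_len_of_le hpq hq)]
      · rw [x.comp_seg 0 p q zero_le hpq hq, y.comp_seg 0 p q zero_le hpq hq',
          hinit q hq]
    · rw [x.seg_junk p q h, y.seg_junk p q (hl ▸ h), hinit 0 (by simp)]
  cases x
  cases y
  simp only at hl hs
  subst hl hs
  rfl

/-- If the segment of `x` from `p` to `q` begins with `a`, then so does `x` at `p`. -/
lemma seg_eq_of_comp_eq (x : GMor Λ) {p q : Fin k → ℕ} (hpq : p ≤ q)
    (hq : ∀ i, (q i : ℕ∞) ≤ x.len i) {a b : Λ.Path} (hab : Λ.s a = Λ.r b)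
    (h : Λ.comp a b = x.seg p q) : p + Λ.d a ≤ q ∧ x.seg p (p + Λ.d a) = a := by
  have hd : q = p + (Λ.d a + Λ.d b) := by
    rw [← Λ.d_comp a b hab, h, x.d_seg p q hpq hq, add_tsub_cancel_of_le hpq]
  have hle : p + Λ.d a ≤ q := by
    rw [hd]
    exact add_le_add_right le_self_add p
  have hp : p ≤ p + Λ.d a := le_self_add
  refine ⟨hle, (cancel (x.s_seg_eq_r_seg hp hle hq) hab ?_ ?_).1⟩
  · rw [x.d_seg _ _ hp (x.le_len_of_le hle hq), add_tsub_cancel_left]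
  · rw [x.comp_seg _ _ _ hp hle hq, h]

/-- There is a graph morphism with any prescribed length and compatible initial segments. -/
lemma exists_of_init (len : Fin k → ℕ∞) (W : (Fin k → ℕ) → Λ.Path)
    (hd : ∀ q : Fin k → ℕ, (∀ i, (q i : ℕ∞) ≤ len i) → Λ.d (W q) = q)
    (hW : ∀ p q : Fin k → ℕ, p ≤ q → (∀ i, (q i : ℕ∞) ≤ len i) → IsPrefix (W p) (W q)) :
    ∃ x : GMor Λ, (∀ i, x.len i = len i) ∧
      ∀ q : Fin k → ℕ, (∀ i, (q i : ℕ∞) ≤ len i) → x.seg 0 q = W q := by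
  have key : ∀ p q : Fin k → ℕ, ∃ c : Λ.Path, p ≤ q → (∀ i, (q i : ℕ∞) ≤ len i) →
      Λ.s (W p) = Λ.r c ∧ Λ.comp (W p) c = W q := by
    intro p q
    by_cases h : p ≤ q ∧ ∀ i, (q i : ℕ∞) ≤ len i
    · obtain ⟨c, hc⟩ := hW p q h.1 h.2
      exact ⟨c, fun _ _ => hc⟩
    · exact ⟨W 0, fun h1 h2 => absurd ⟨h1, h2⟩ h⟩
  choose c hc using key
  have hle : ∀ {p q : Fin k → ℕ}, p ≤ q → (∀ i, (q i : ℕ∞) ≤ len i) →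
      ∀ i, (p i : ℕ∞) ≤ len i := fun h hq i => (Nat.cast_le.2 (h i)).trans (hq i)
  have hcd : ∀ p q : Fin k → ℕ, p ≤ q → (∀ i, (q i : ℕ∞) ≤ len i) → Λ.d (c p q) = q - p := by
    intro p q hpq hq
    obtain ⟨h1, h2⟩ := hc p q hpq hq
    have h3 := Λ.d_comp _ _ h1
    rw [h2, hd q hq, hd p (hle hpq hq)] at h3
    exact (tsub_eq_of_eq_add_rev h3).symm
  have hcc : ∀ p : Fin k → ℕ, (∀ i, (p i : ℕ∞) ≤ len i) → c p p = Λ.s (W p) := by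
    intro p hp
    obtain ⟨h1, h2⟩ := hc p p le_rfl hp
    exact (cancel h1 (Λ.r_s (W p)).symm rfl (h2.trans (Λ.comp_source _).symm)).2
  have hr : ∀ p q : Fin k → ℕ, p ≤ q → (∀ i, (q i : ℕ∞) ≤ len i) → Λ.r (c p q) = c p p := by
    intro p q hpq hq
    rw [hcc p (hle hpq hq), (hc p q hpq hq).1]
  have hs : ∀ p q : Fin k → ℕ, p ≤ q → (∀ i, (q i : ℕ∞) ≤ len i) → Λ.s (c p q) = c q q := by
    intro p q hpq hq
    obtain ⟨h1, h2⟩ := hc p q hpq hq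
    rw [hcc q hq, ← h2, Λ.s_comp _ _ h1]
  have hcomp : ∀ p q u : Fin k → ℕ, p ≤ q → q ≤ u → (∀ i, (u i : ℕ∞) ≤ len i) →
      Λ.comp (c p q) (c q u) = c p u := by
    intro p q u hpq hqu hu
    have hq := hle hqu hu
    obtain ⟨h1, h2⟩ := hc p q hpq hq
    obtain ⟨h3, h4⟩ := hc q u hqu hu
    obtain ⟨h5, h6⟩ := hc p u (hpq.trans hqu) hu
    have h7 : Λ.s (c p q) = Λ.r (c q u) := by rw [hs p q hpq hq, hr q u hqu hu]
    refine (cancel ?_ h5 rfl ?_).2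
    · rw [Λ.r_comp _ _ h7, h1]
    · rw [← Λ.comp_assoc _ _ _ h1 h7, h2, h4, h6]
  refine ⟨⟨len, fun p q => if p ≤ q ∧ ∀ i, (q i : ℕ∞) ≤ len i then c p q else c 0 0,
    ?_, ?_, ?_, ?_, ?_⟩, fun _ => rfl, ?_⟩
  · intro p q hpq hq
    rw [if_pos ⟨hpq, hq⟩, hcd p q hpq hq]
  · intro p q hpq hq
    rw [if_pos ⟨hpq, hq⟩, if_pos ⟨le_rfl, hle hpq hq⟩, hr p q hpq hq]
  · intro p q hpq hq
    rw [if_pos ⟨hpq, hq⟩, if_pos ⟨le_rfl, hq⟩, hs p q hpq hq]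
  · intro p q u hpq hqu hu
    rw [if_pos ⟨hpq, hle hqu hu⟩, if_pos ⟨hqu, hu⟩, if_pos ⟨hpq.trans hqu, hu⟩,
      hcomp p q u hpq hqu hu]
  · intro p q h
    rw [if_neg h, if_pos ⟨le_rfl, by simp⟩]
  · intro q hq
    have h0 : ∀ i, ((0 : Fin k → ℕ) i : ℕ∞) ≤ len i := by simp
    obtain ⟨h1, h2⟩ := hc 0 q zero_le hq
    have hv : Λ.IsVertex (W 0) := hd 0 h0
    show (if _ then _ else _) = _
    rw [if_pos ⟨zero_le, hq⟩, ← h2, ← hv.s_eq, h1, Λ.range_comp]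

lemma IsExtension.source_eq {x y : GMor Λ} {lam : Λ.Path} (h : y.IsExtension lam x) :
    Λ.s lam = x.range := by
  obtain ⟨h1, h2, h3⟩ := h
  have h4 := h3 0 (by simp)
  rw [add_zero] at h4
  rw [range, ← h4]
  conv_lhs => rw [← h2]
  exact y.s_seg _ _ zero_le fun i => by rw [h1 i]; exact le_self_add

lemma IsExtension.d_le {x y : GMor Λ} {lam : Λ.Path} (h : y.IsExtension lam x) (i : Fin k) :
    (Λ.d lam i : ℕ∞) ≤ y.len i := by
  rw [h.1 i]
  exact le_self_add

lemma IsExtension.add_le {x y : GMor Λ} {lam : Λ.Path} (h : y.IsExtension lam x)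
    {q : Fin k → ℕ} (hq : ∀ i, (q i : ℕ∞) ≤ x.len i) (i : Fin k) :
    ((Λ.d lam + q) i : ℕ∞) ≤ y.len i := by
  rw [h.1 i, Pi.add_apply, Nat.cast_add]
  exact add_le_add_right (hq i) _

lemma IsExtension.sub_le {x y : GMor Λ} {lam : Λ.Path} (h : y.IsExtension lam x)
    {q : Fin k → ℕ} (hq : ∀ i, (q i : ℕ∞) ≤ y.len i) (i : Fin k) :
    ((q - Λ.d lam) i : ℕ∞) ≤ x.len i := by
  rw [Pi.sub_apply, ENat.natCast_sub, tsub_le_iff_left, ← h.1 i]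
  exact hq i

lemma IsExtension.init_add {x y : GMor Λ} {lam : Λ.Path} (h : y.IsExtension lam x)
    {q : Fin k → ℕ} (hq : ∀ i, (q i : ℕ∞) ≤ x.len i) :
    y.seg 0 (Λ.d lam + q) = Λ.comp lam (x.seg 0 q) := by
  rw [← y.comp_seg 0 (Λ.d lam) _ zero_le le_self_add (h.add_le hq), h.2.1, h.2.2 q hq]

lemma isExtension_of_init {x y : GMor Λ} {lam : Λ.Path} (hlam : Λ.s lam = x.range)
    (hlen : ∀ i, y.len i = (Λ.d lam i : ℕ∞) + x.len i)
    (hinit : ∀ q : Fin k → ℕ, (∀ i, (q i : ℕ∞) ≤ x.len i) →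
      y.seg 0 (Λ.d lam + q) = Λ.comp lam (x.seg 0 q)) :
    y.IsExtension lam x := by
  have h0 : y.seg 0 (Λ.d lam) = lam := by
    have := hinit 0 (by simp)
    rw [add_zero] at this
    rw [this]
    exact (congrArg _ hlam.symm).trans (Λ.comp_source lam)
  refine ⟨hlen, h0, fun q hq => ?_⟩
  have hq' : ∀ i, ((Λ.d lam + q) i : ℕ∞) ≤ y.len i := by
    intro i
    rw [hlen i, Pi.add_apply, Nat.cast_add]
    exact add_le_add_right (hq i) _
  have hs := y.s_seg_eq_r_seg zero_le (le_self_add (a := Λ.d lam) (b := q)) hq'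
  refine (cancel hs (a' := lam) (b' := x.seg 0 q) ?_ ?_ ?_).2
  · rw [hlam, x.r_init hq]
  · rw [h0]
  · rw [y.comp_seg _ _ _ zero_le le_self_add hq', hinit q hq]

lemma IsExtension.seg_add {x y : GMor Λ} {lam : Λ.Path} (h : y.IsExtension lam x)
    {p q : Fin k → ℕ} (hpq : p ≤ q) (hq : ∀ i, (q i : ℕ∞) ≤ x.len i) :
    y.seg (Λ.d lam + p) (Λ.d lam + q) = x.seg p q := by
  have hpq' : Λ.d lam + p ≤ Λ.d lam + q := add_le_add_right hpq _
  have hp := x.le_len_of_le hpq hq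
  have hs : Λ.s lam = Λ.r (x.seg 0 p) := by rw [h.source_eq, x.r_init hp]
  have hx := x.s_seg_eq_r_seg zero_le hpq hq
  refine (cancel (y.s_seg_eq_r_seg zero_le hpq' (h.add_le hq))
    (a' := Λ.comp lam (x.seg 0 p)) (b' := x.seg p q) ?_ ?_ ?_).2
  · rw [Λ.s_comp _ _ hs, hx]
  · rw [h.init_add hp]
  · rw [y.comp_seg _ _ _ zero_le hpq' (h.add_le hq), h.init_add hq,
      Λ.comp_assoc _ _ _ hs hx, x.comp_seg _ _ _ zero_le hpq hq]

lemma IsExtension.ext_left {x y y' : GMor Λ} {lam : Λ.Path} (h : y.IsExtension lam x)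
    (h' : y'.IsExtension lam x) : y = y' := by
  refine ext_init (fun i => by rw [h.1 i, h'.1 i]) fun q hq => ?_
  have hq1 := h.sub_le hq
  have hle : q ≤ Λ.d lam + (q - Λ.d lam) := le_add_tsub
  have hq2 : ∀ i, (q i : ℕ∞) ≤ y'.len i := fun i => by rw [h'.1 i, ← h.1 i]; exact hq i
  refine (y.isPrefix_init hle (h.add_le hq1)).eq_of_d_eq (c := y.seg 0 _) ?_ ?_
  · rw [h.init_add hq1, ← h'.init_add hq1]
    exact y'.isPrefix_init hle (h'.add_le hq1)
  · rw [y.d_init hq, y'.d_init hq2]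

lemma IsExtension.ext_right {x x' y : GMor Λ} {lam : Λ.Path} (h : y.IsExtension lam x)
    (h' : y.IsExtension lam x') : x = x' := by
  have hl : ∀ i, x.len i = x'.len i := fun i =>
    WithTop.add_left_cancel (ENat.natCast_ne_top (Λ.d lam i)) ((h.1 i).symm.trans (h'.1 i))
  refine ext_init hl fun q hq => ?_
  rw [← h.2.2 q hq, h'.2.2 q fun i => hl i ▸ hq i]

lemma IsExtension.comp {x y z : GMor Λ} {lam mu : Λ.Path} (hz : z.IsExtension lam y)
    (hy : y.IsExtension mu x) : z.IsExtension (Λ.comp lam mu) x := by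
  have hs : Λ.s lam = Λ.r mu := by
    rw [hz.source_eq, ← y.r_init hy.d_le, hy.2.1]
  refine isExtension_of_init ?_ (fun i => ?_) fun q hq => ?_
  · rw [Λ.s_comp _ _ hs, hy.source_eq]
  · rw [hz.1 i, hy.1 i, Λ.d_comp _ _ hs, Pi.add_apply, Nat.cast_add, add_assoc]
  · rw [Λ.d_comp _ _ hs, add_assoc, hz.init_add (hy.add_le hq), hy.init_add hq,
      Λ.comp_assoc _ _ _ hs]
    rw [hy.source_eq, x.r_init hq]

/-- Every path can be prepended to a graph morphism starting at its source. -/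
lemma exists_isExtension (lam : Λ.Path) (x : GMor Λ) (h : Λ.s lam = x.range) :
    ∃ y : GMor Λ, y.IsExtension lam x := by
  have hsub : ∀ q : Fin k → ℕ, (∀ i, (q i : ℕ∞) ≤ (Λ.d lam i : ℕ∞) + x.len i) →
      ∀ i, ((q - Λ.d lam) i : ℕ∞) ≤ x.len i := by
    intro q hq i
    rw [Pi.sub_apply, ENat.natCast_sub, tsub_le_iff_left]
    exact hq i
  have hs : ∀ q : Fin k → ℕ, (∀ i, (q i : ℕ∞) ≤ x.len i) → Λ.s lam = Λ.r (x.seg 0 q) :=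
    fun q hq => by rw [h, x.r_init hq]
  have hd : ∀ q : Fin k → ℕ, (∀ i, (q i : ℕ∞) ≤ (Λ.d lam i : ℕ∞) + x.len i) →
      q ≤ Λ.d (Λ.comp lam (x.seg 0 (q - Λ.d lam))) := by
    intro q hq
    rw [Λ.d_comp _ _ (hs _ (hsub q hq)), x.d_init (hsub q hq)]
    exact le_add_tsub
  have hW : ∀ q : Fin k → ℕ, (∀ i, (q i : ℕ∞) ≤ (Λ.d lam i : ℕ∞) + x.len i) →
      Λ.d (Λ.seg (Λ.comp lam (x.seg 0 (q - Λ.d lam))) 0 q) = q := by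
    intro q hq
    rw [seg_zero]
    exact (split_spec (hd q hq)).2.1
  obtain ⟨y, hlen, hy⟩ := exists_of_init (fun i => (Λ.d lam i : ℕ∞) + x.len i)
    (fun q => Λ.seg (Λ.comp lam (x.seg 0 (q - Λ.d lam))) 0 q) hW (by
      intro p q hpq hq
      have hp : ∀ i, (p i : ℕ∞) ≤ (Λ.d lam i : ℕ∞) + x.len i := fun i =>
        (Nat.cast_le.2 (hpq i)).trans (hq i)
      have hpq' : p - Λ.d lam ≤ q - Λ.d lam := tsub_le_tsub_right hpq _
      refine IsPrefix.of_d_le ?_ (isPrefix_seg_zero (hd q hq)) ?_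
      · exact (isPrefix_seg_zero (hd p hp)).trans
          ((x.isPrefix_init hpq' (hsub q hq)).comp_left (hs _ (hsub p hp)))
      · rw [hW p hp, hW q hq]
        exact hpq)
  refine ⟨y, isExtension_of_init h hlen fun q hq => ?_⟩
  rw [hy]
  · have hd' : Λ.d lam + q = Λ.d (Λ.comp lam (x.seg 0 q)) := by
      rw [Λ.d_comp _ _ (hs q hq), x.d_init hq]
    simp only [add_tsub_cancel_left]
    rw [hd']
    conv_lhs => enter [2]; rw [← Λ.comp_source (Λ.comp lam (x.seg 0 q))]
    exact seg_zero_comp (Λ.r_s _).symm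
  · intro i
    rw [Pi.add_apply, Nat.cast_add]
    exact add_le_add_right (hq i) _

/-- Initial segments can be removed from a graph morphism. -/
lemma exists_isExtension_of_init {lam : Λ.Path} {y : GMor Λ}
    (hd : ∀ i, (Λ.d lam i : ℕ∞) ≤ y.len i) (h : y.seg 0 (Λ.d lam) = lam) :
    ∃ x : GMor Λ, y.IsExtension lam x := by
  have hadd : ∀ q : Fin k → ℕ, (∀ i, (q i : ℕ∞) ≤ y.len i - (Λ.d lam i : ℕ∞)) →
      ∀ i, ((Λ.d lam + q) i : ℕ∞) ≤ y.len i := by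
    intro q hq i
    rw [Pi.add_apply, Nat.cast_add]
    calc (Λ.d lam i : ℕ∞) + q i ≤ Λ.d lam i + (y.len i - Λ.d lam i) := add_le_add_right (hq i) _
      _ = y.len i := add_tsub_cancel_of_le (hd i)
  obtain ⟨x, hlen, hx⟩ := exists_of_init (fun i => y.len i - (Λ.d lam i : ℕ∞))
    (fun q => y.seg (Λ.d lam) (Λ.d lam + q))
    (fun q hq => by rw [y.d_seg _ _ le_self_add (hadd q hq), add_tsub_cancel_left])
    (fun p q hpq hq => by
      have hpq' : Λ.d lam + p ≤ Λ.d lam + q := add_le_add_right hpq _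
      exact ⟨_, y.s_seg_eq_r_seg le_self_add hpq' (hadd q hq),
        y.comp_seg _ _ _ le_self_add hpq' (hadd q hq)⟩)
  refine ⟨x, fun i => ?_, h, fun q hq => ?_⟩
  · rw [hlen i, add_tsub_cancel_of_le (hd i)]
  · rw [hx q fun i => hlen i ▸ hq i]

lemma isExtension_vertex {v : Λ.Path} (hv : Λ.IsVertex v) (x : GMor Λ) (h : v = x.range) :
    x.IsExtension v x := by
  have hv' : Λ.d v = 0 := hv
  refine ⟨fun i => by simp [hv'], ?_, fun q _ => ?_⟩
  · rw [hv', h, range]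
  · rw [hv', zero_add]

/-- If `z` begins with both `lam` and `mu` then it begins with a minimal common extension. -/
lemma exists_mem_Lmin {lam mu : Λ.Path} {x y z : GMor Λ} (hx : z.IsExtension mu x)
    (hy : z.IsExtension lam y) :
    ∃ p ∈ Λ.Lmin lam mu, ∃ w : GMor Λ, y.IsExtension p.1 w ∧ x.IsExtension p.2 w := by
  set n := Λ.d lam ⊔ Λ.d mu with hn
  have hnz : ∀ i, (n i : ℕ∞) ≤ z.len i := by
    intro i
    rw [hn, Pi.sup_apply]
    rcases le_total (Λ.d lam i) (Λ.d mu i) with h | h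
    · rw [sup_eq_right.2 h]
      exact hx.d_le i
    · rw [sup_eq_left.2 h]
      exact hy.d_le i
  have hl : Λ.d lam + (n - Λ.d lam) = n := add_tsub_cancel_of_le le_sup_left
  have hm : Λ.d mu + (n - Λ.d mu) = n := add_tsub_cancel_of_le le_sup_right
  have hy1 := hy.sub_le hnz
  have hx1 := hx.sub_le hnz
  have hy2 := hy.init_add hy1
  have hx2 := hx.init_add hx1
  rw [hl] at hy2
  rw [hm] at hx2
  have hdy := y.d_init hy1
  have hdx := x.d_init hx1
  have hp : (y.seg 0 (n - Λ.d lam), x.seg 0 (n - Λ.d mu)) ∈ Λ.Lmin lam mu := by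
    refine mem_Lmin.2 ⟨?_, ?_, hy2.symm.trans hx2, ?_⟩
    · rw [hy.source_eq, y.r_init hy1]
    · rw [hx.source_eq, x.r_init hx1]
    · rw [hdy, hl]
  obtain ⟨w, hw⟩ := exists_isExtension_of_init (lam := y.seg 0 (n - Λ.d lam)) (y := y)
    (by rw [hdy]; exact hy1) (by rw [hdy])
  obtain ⟨w', hw'⟩ := exists_isExtension_of_init (lam := x.seg 0 (n - Λ.d mu)) (y := x)
    (by rw [hdx]; exact hx1) (by rw [hdx])
  have h1 := hy.comp hw
  have h2 := hx.comp hw'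
  rw [← hx2, hy2] at h2
  have hww := h1.ext_right h2
  subst hww
  exact ⟨_, hp, w, hw, hw'⟩

/-- The minimal common extension with which a graph morphism begins is unique. -/
lemma eq_of_mem_Lmin {lam mu : Λ.Path} {x w w' : GMor Λ} {p q : Λ.Path × Λ.Path}
    (hp : p ∈ Λ.Lmin lam mu) (hq : q ∈ Λ.Lmin lam mu) (hxp : x.IsExtension p.2 w)
    (hxq : x.IsExtension q.2 w') : p = q := by
  obtain ⟨hp1, hp2, hp3, hp4⟩ := mem_Lmin.1 hp
  obtain ⟨hq1, hq2, hq3, hq4⟩ := mem_Lmin.1 hq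
  have hd : Λ.d p.2 = Λ.d q.2 := by
    rw [← Λ.d_comp _ _ hp1, hp3, Λ.d_comp _ _ hp2] at hp4
    rw [← Λ.d_comp _ _ hq1, hq3, Λ.d_comp _ _ hq2] at hq4
    exact add_left_cancel (hp4.trans hq4.symm)
  have h2 : p.2 = q.2 := by rw [← hxp.2.1, ← hxq.2.1, hd]
  have h1 : p.1 = q.1 := by
    refine (cancel hp1 hq1 rfl ?_).2
    rw [hp3, hq3, h2]
  exact Prod.ext h1 h2

lemma IsExtension.isBdry_of {x y : GMor Λ} {lam : Λ.Path} (h : y.IsExtension lam x)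
    {𝓔 : Set (Set Λ.Path)} (hy : Λ.IsBdry 𝓔 y) : Λ.IsBdry 𝓔 x := by
  intro n hn E hE hF
  rw [← h.seg_add le_rfl hn] at hF
  obtain ⟨nu, hnu, h1, h2⟩ := hy _ (h.add_le hn) E hE hF
  have h1' : ∀ i, ((n + Λ.d nu) i : ℕ∞) ≤ x.len i := by
    intro i
    have h3 := h1 i
    rw [h.1 i, add_assoc, Pi.add_apply, Nat.cast_add] at h3
    exact (ENat.add_le_add_iff_left (ENat.natCast_ne_top _)).1 h3
  refine ⟨nu, hnu, h1', ?_⟩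
  rw [← h.seg_add le_self_add h1', ← add_assoc, h2]

lemma IsExtension.isBdry {x y : GMor Λ} {lam : Λ.Path} (h : y.IsExtension lam x)
    {𝓔 : Set (Set Λ.Path)} (h𝓔 : Λ.Satiated 𝓔) (hx : Λ.IsBdry 𝓔 x) : Λ.IsBdry 𝓔 y := by
  intro n hn E hE hF
  have hnx := h.sub_le hn
  have hm := h.add_le hnx
  have hnm : n ≤ Λ.d lam + (n - Λ.d lam) := le_add_tsub
  have hr := y.r_seg _ _ hnm hm
  by_cases hmem : y.seg n (Λ.d lam + (n - Λ.d lam)) ∈ Λ.setLam E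
  · obtain ⟨nu, hnu, b, hb, hc⟩ := hmem
    obtain ⟨h1, h2⟩ := y.seg_eq_of_comp_eq hnm hm hb hc
    exact ⟨nu, hnu, y.le_len_of_le h1 hm, h2⟩
  have hExt := h𝓔.2.2.1 E hE _ hF _ hr hmem
  have hsx : Λ.s (y.seg n (Λ.d lam + (n - Λ.d lam))) = x.seg (n - Λ.d lam) (n - Λ.d lam) := by
    rw [y.s_seg _ _ hnm hm, h.seg_add le_rfl hnx]
  have hFE : Λ.FEat (x.seg (n - Λ.d lam) (n - Λ.d lam))
      (Λ.Ext (y.seg n (Λ.d lam + (n - Λ.d lam))) E) := by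
    obtain ⟨v, hv⟩ := h𝓔.1 hExt
    obtain ⟨a, ha⟩ := hF.2.2.2 _ hr
    have hva : v = x.seg (n - Λ.d lam) (n - Λ.d lam) := by
      rw [← (hv.2.1 a ha).1, ha.1, hsx]
    rwa [← hva]
  obtain ⟨a, ⟨-, nu, hnu, b, hab⟩, hlen, hseg⟩ := hx _ hnx _ hExt hFE
  obtain ⟨-, h2, h3, -⟩ := mem_Lmin.1 hab
  have hlen' := h.add_le hlen
  have hma : Λ.d lam + (n - Λ.d lam) ≤ Λ.d lam + (n - Λ.d lam + Λ.d a) :=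
    add_le_add_right le_self_add _
  have hya := h.seg_add (le_self_add (a := n - Λ.d lam) (b := Λ.d a)) hlen
  rw [hseg] at hya
  have hcomp := y.comp_seg _ _ _ hnm hma hlen'
  rw [hya] at hcomp
  obtain ⟨h4, h5⟩ := y.seg_eq_of_comp_eq (hnm.trans hma) hlen' h2 (h3.symm.trans hcomp)
  exact ⟨nu, hnu, y.le_len_of_le h4 hlen', h5⟩

end GMor

section SequenceSpace

variable {ι : Type*} [DecidableEq ι]

/-- Bounded operators on `ℓ²(ι)` which agree on the canonical basis are equal. -/
lemma clm_ext_single {T U : lp (fun _ : ι => ℂ) 2 →L[ℂ] lp (fun _ : ι => ℂ) 2}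
    (h : ∀ i, T (lp.single 2 i 1) = U (lp.single 2 i 1)) : T = U := by
  ext1 f
  have hf := lp.hasSum_single (p := 2) (by norm_num) f
  refine (hf.mapL T).unique ?_
  have h1 : ∀ i, T (lp.single 2 i (f i)) = U (lp.single 2 i (f i)) := by
    intro i
    have h2 : lp.single (E := fun _ : ι => ℂ) 2 i (f i)
        = f i • lp.single (E := fun _ : ι => ℂ) 2 i 1 := by
      rw [← lp.single_smul, smul_eq_mul, mul_one]
    rw [h2, map_smul, map_smul, h i]
  simp_rw [h1]
  exact hf.mapL U

lemma inner_star_apply_single (T : lp (fun _ : ι => ℂ) 2 →L[ℂ] lp (fun _ : ι => ℂ) 2) (i j : ι) :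
    (star T (lp.single 2 j 1)) i = inner ℂ (T (lp.single 2 i 1)) (lp.single 2 j 1) := by
  rw [← ContinuousLinearMap.adjoint_inner_right, ← ContinuousLinearMap.star_eq_adjoint,
    lp.inner_single_left]
  simp

variable {T : lp (fun _ : ι => ℂ) 2 →L[ℂ] lp (fun _ : ι => ℂ) 2} {R : ι → ι → Prop}

lemma star_apply_single_of_rel (hR : ∀ i j, R i j → T (lp.single 2 i 1) = lp.single 2 j 1)
    (h0 : ∀ i, (∀ j, ¬ R i j) → T (lp.single 2 i 1) = 0)
    (hinj : ∀ i i' j, R i j → R i' j → i = i') {i j : ι} (hij : R i j) :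
    star T (lp.single 2 j 1) = lp.single 2 i 1 := by
  ext l
  rw [inner_star_apply_single, lp.single_apply]
  by_cases hl : ∃ m, R l m
  · obtain ⟨m, hm⟩ := hl
    rw [hR l m hm, lp.inner_single_left, lp.single_apply]
    by_cases hmj : m = j
    · subst hmj
      rw [hinj l i m hm hij]
      simp
    · have hli : l ≠ i := by
        rintro rfl
        have h1 := (hR l m hm).symm.trans (hR l j hij)
        have h2 := congrArg (fun f : lp (fun _ : ι => ℂ) 2 => f m) h1
        simp [lp.single_apply, hmj] at h2
      simp [hmj, hli]
  · have hli : l ≠ i := by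
      rintro rfl
      exact hl ⟨j, hij⟩
    rw [h0 l (not_exists.1 hl)]
    simp [hli]

lemma star_apply_single_of_not_rel
    (hR : ∀ i j, R i j → T (lp.single 2 i 1) = lp.single 2 j 1)
    (h0 : ∀ i, (∀ j, ¬ R i j) → T (lp.single 2 i 1) = 0) {j : ι} (hj : ∀ i, ¬ R i j) :
    star T (lp.single 2 j 1) = 0 := by
  ext l
  rw [inner_star_apply_single]
  by_cases hl : ∃ m, R l m
  · obtain ⟨m, hm⟩ := hl
    have hmj : m ≠ j := by
      rintro rfl
      exact hj l hm
    rw [hR l m hm, lp.inner_single_left, lp.single_apply]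
    simp [hmj]
  · rw [h0 l (not_exists.1 hl)]
    simp

end SequenceSpace

/-- A product of operators each of which fixes or kills `v` kills `v` as soon as one factor
does. -/
lemma list_prod_apply_eq_zero {R M : Type*} [Semiring R] [TopologicalSpace M] [AddCommMonoid M]
    [Module R M] (l : List (M →L[R] M)) (v : M) (h : ∀ T ∈ l, T v = v ∨ T v = 0)
    (h0 : ∃ T ∈ l, T v = 0) : l.prod v = 0 := by
  have hfix : ∀ l : List (M →L[R] M), (∀ T ∈ l, T v = v ∨ T v = 0) →
      l.prod v = v ∨ l.prod v = 0 := by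
    intro l
    induction l with
    | nil => intro _; left; simp
    | cons T l ih =>
      intro hl
      rw [List.forall_mem_cons] at hl
      rw [List.prod_cons, mul_apply_eq_comp]
      rcases ih hl.2 with h1 | h1
      · rw [h1]
        exact hl.1
      · right
        rw [h1, map_zero]
  induction l with
  | nil => simp at h0
  | cons T l ih =>
    rw [List.forall_mem_cons] at h
    rw [List.prod_cons, mul_apply_eq_comp]
    obtain ⟨U, hU, hU0⟩ := h0
    rcases List.mem_cons.1 hU with rfl | hU
    · rcases hfix l h.2 with h1 | h1
      · rw [h1, hU0]
      · rw [h1, map_zero]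
    · rw [ih h.2 ⟨U, hU, hU0⟩, map_zero]

/-- Lemma 4.7: the `𝓔`-compatible boundary-path representation
`{S_𝓔(λ)}` on `ℓ²(∂(Λ;𝓔))` is a relative Cuntz-Krieger `(Λ;𝓔)`-family. -/
theorem statement3 {k : ℕ} (Λ : KGraph k) (hΛ : Λ.FinitelyAligned)
    (𝓔 : Set (Set Λ.Path)) (h𝓔 : Λ.Satiated 𝓔)
    (S : Λ.Path →
      (lp (fun _ : {x : GMor Λ // Λ.IsBdry 𝓔 x} => ℂ) 2 →L[ℂ]
        lp (fun _ : {x : GMor Λ // Λ.IsBdry 𝓔 x} => ℂ) 2))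
    (hS : ∀ (lam : Λ.Path) (x y : {x : GMor Λ // Λ.IsBdry 𝓔 x}),
      Λ.s lam = x.1.range → y.1.IsExtension lam x.1 →
      S lam (lp.single 2 x 1) = lp.single 2 y 1)
    (hS0 : ∀ (lam : Λ.Path) (x : {x : GMor Λ // Λ.IsBdry 𝓔 x}),
      Λ.s lam ≠ x.1.range → S lam (lp.single 2 x 1) = 0) :
    Λ.RCKFamily 𝓔 S := by
  have hR : ∀ (lam : Λ.Path) (x y : {x : GMor Λ // Λ.IsBdry 𝓔 x}),
      y.1.IsExtension lam x.1 → S lam (lp.single 2 x 1) = lp.single 2 y 1 :=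
    fun lam x y h => hS lam x y h.source_eq h
  have hex : ∀ (lam : Λ.Path) (x : {x : GMor Λ // Λ.IsBdry 𝓔 x}), Λ.s lam = x.1.range →
      ∃ y : {x : GMor Λ // Λ.IsBdry 𝓔 x}, y.1.IsExtension lam x.1 := by
    intro lam x h
    obtain ⟨y, hy⟩ := GMor.exists_isExtension lam x.1 h
    exact ⟨⟨y, hy.isBdry h𝓔 x.2⟩, hy⟩
  have hR0 : ∀ (lam : Λ.Path) (x : {x : GMor Λ // Λ.IsBdry 𝓔 x}),
      (∀ y : {x : GMor Λ // Λ.IsBdry 𝓔 x}, ¬ y.1.IsExtension lam x.1) →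
      S lam (lp.single 2 x 1) = 0 := by
    intro lam x h
    refine hS0 lam x fun hs => ?_
    obtain ⟨y, hy⟩ := hex lam x hs
    exact h y hy
  have hstar : ∀ (lam : Λ.Path) (x y : {x : GMor Λ // Λ.IsBdry 𝓔 x}),
      y.1.IsExtension lam x.1 → star (S lam) (lp.single 2 y 1) = lp.single 2 x 1 :=
    fun lam x y h => star_apply_single_of_rel
      (R := fun x y : {x : GMor Λ // Λ.IsBdry 𝓔 x} => y.1.IsExtension lam x.1) (hR lam) (hR0 lam)
      (fun i i' j h1 h2 => Subtype.ext (h1.ext_right h2)) h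
  have hstar0 : ∀ (lam : Λ.Path) (y : {x : GMor Λ // Λ.IsBdry 𝓔 x}),
      (∀ x : GMor Λ, ¬ y.1.IsExtension lam x) → star (S lam) (lp.single 2 y 1) = 0 :=
    fun lam y h => star_apply_single_of_not_rel
      (R := fun x y : {x : GMor Λ // Λ.IsBdry 𝓔 x} => y.1.IsExtension lam x.1) (hR lam) (hR0 lam)
      fun x => h x.1
  have hvert : ∀ (v : Λ.Path) (x : {x : GMor Λ // Λ.IsBdry 𝓔 x}), Λ.IsVertex v →
      v = x.1.range → S v (lp.single 2 x 1) = lp.single 2 x 1 :=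
    fun v x hv h => hR v x x (GMor.isExtension_vertex hv x.1 h)
  have hvert0 : ∀ (v : Λ.Path) (x : {x : GMor Λ // Λ.IsBdry 𝓔 x}), Λ.IsVertex v →
      v ≠ x.1.range → S v (lp.single 2 x 1) = 0 :=
    fun v x hv h => hS0 v x (by rwa [hv.s_eq])
  refine ⟨⟨fun v hv => ⟨?_, ?_⟩, fun v w hv hw hvw => ?_, fun lam mu hlm => ?_,
    fun lam mu => ?_⟩, fun E hE v hF => ?_⟩
  · refine clm_ext_single fun x => ?_
    by_cases h : v = x.1.range
    · rw [hvert v x hv h, hstar v x x (GMor.isExtension_vertex hv x.1 h)]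
    · rw [hvert0 v x hv h, hstar0 v x fun z hz => h ?_]
      have h1 := x.1.r_init hz.d_le
      rwa [hz.2.1, hv.r_eq] at h1
  · refine clm_ext_single fun x => ?_
    rw [mul_apply_eq_comp]
    by_cases h : v = x.1.range
    · rw [hvert v x hv h, hvert v x hv h]
    · rw [hvert0 v x hv h, map_zero]
  · refine clm_ext_single fun x => ?_
    rw [mul_apply_eq_comp, zero_apply]
    by_cases h : w = x.1.range
    · rw [hvert w x hw h, hvert0 v x hv (h ▸ hvw)]
    · rw [hvert0 w x hw h, map_zero]
  · refine clm_ext_single fun x => ?_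
    rw [mul_apply_eq_comp]
    by_cases h : Λ.s mu = x.1.range
    · obtain ⟨y, hy⟩ := hex mu x h
      have hyr : Λ.s lam = y.1.range := by rw [hlm, ← y.1.r_init hy.d_le, hy.2.1]
      obtain ⟨z, hz⟩ := hex lam y hyr
      rw [hR mu x y hy, hR lam y z hz, hR _ x z (hz.comp hy)]
    · rw [hS0 mu x h, map_zero, hS0 _ x (by rwa [Λ.s_comp _ _ hlm])]
  · have hfin := KGraph.finite_Lmin hΛ lam mu
    refine clm_ext_single fun x => ?_
    rw [finsum_mem_eq_finite_toFinset_sum _ hfin, sum_apply,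
      mul_apply_eq_comp]
    simp_rw [mul_apply_eq_comp]
    by_cases hz : ∃ z : {x : GMor Λ // Λ.IsBdry 𝓔 x}, z.1.IsExtension mu x.1 ∧
        ∃ y, z.1.IsExtension lam y
    · obtain ⟨z, hzx, y, hzy⟩ := hz
      rw [hR mu x z hzx, hstar lam ⟨y, hzy.isBdry_of z.2⟩ z hzy]
      obtain ⟨p, hp, w, hyw, hxw⟩ := GMor.exists_mem_Lmin hzx hzy
      rw [Finset.sum_eq_single p]
      · rw [hstar p.2 ⟨w, hxw.isBdry_of x.2⟩ x hxw,
          hR p.1 ⟨w, hxw.isBdry_of x.2⟩ ⟨y, hzy.isBdry_of z.2⟩ hyw]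
      · intro q hq hqp
        rw [hstar0 q.2 x fun w' hw' => hqp
          (GMor.eq_of_mem_Lmin (hfin.mem_toFinset.1 hq) hp hw' hxw), map_zero]
      · intro h
        exact absurd (hfin.mem_toFinset.2 hp) h
    · have hleft : star (S lam) (S mu (lp.single 2 x 1)) = 0 := by
        by_cases h : Λ.s mu = x.1.range
        · obtain ⟨z, hzx⟩ := hex mu x h
          rw [hR mu x z hzx, hstar0 lam z fun y hy => hz ⟨z, hzx, y, hy⟩]
        · rw [hS0 mu x h, map_zero]
      rw [hleft, Finset.sum_eq_zero]
      intro q hq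
      obtain ⟨h1, h2, h3, -⟩ := KGraph.mem_Lmin.1 (hfin.mem_toFinset.1 hq)
      rw [hstar0 q.2 x, map_zero]
      intro w hw
      obtain ⟨z, hzx⟩ := hex mu x (by rw [h2, ← x.1.r_init hw.d_le, hw.2.1])
      have hwb := hw.isBdry_of x.2
      obtain ⟨y, hyw⟩ := hex q.1 ⟨w, hwb⟩ (by
        rw [← hw.source_eq, ← Λ.s_comp _ _ h2, ← h3, Λ.s_comp _ _ h1])
      obtain ⟨z', hz'⟩ := hex lam y (by rw [h1, ← y.1.r_init hyw.d_le, hyw.2.1])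
      have hzw := hz'.comp hyw
      rw [h3] at hzw
      have hzz : z'.1 = z.1 := hzw.ext_left (hzx.comp hw)
      exact hz ⟨z, hzx, y.1, hzz ▸ hz'⟩
  · refine clm_ext_single fun x => ?_
    have hrange : ∀ lam ∈ E, ∀ y : GMor Λ, x.1.IsExtension lam y → v = x.1.range := by
      intro lam hlam y hy
      rw [← x.1.r_init hy.d_le, hy.2.1, (hF.2.1 lam hlam).1]
    have hne : E.Nonempty := by
      obtain ⟨a, -, nu, hnu, -⟩ := hF.2.2.2 v hF.1.r_eq
      exact ⟨nu, hnu⟩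
    rw [KGraph.gapProd, listProd, dif_pos hF.2.2.1, zero_apply]
    have hgap : ∀ lam ∈ E, ∀ y : GMor Λ, x.1.IsExtension lam y →
        (S v - S lam * star (S lam)) (lp.single 2 x 1) = 0 := by
      intro lam hlam y hy
      rw [sub_apply, mul_apply_eq_comp,
        hvert v x hF.1 (hrange lam hlam y hy), hstar lam ⟨y, hy.isBdry_of x.2⟩ x hy,
        hR lam ⟨y, hy.isBdry_of x.2⟩ x hy, sub_self]
    have hgap0 : ∀ lam, (∀ y : GMor Λ, ¬ x.1.IsExtension lam y) →
        (S v - S lam * star (S lam)) (lp.single 2 x 1) = S v (lp.single 2 x 1) := by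
      intro lam hlam
      rw [sub_apply, mul_apply_eq_comp, hstar0 lam x hlam,
        map_zero, sub_zero]
    apply list_prod_apply_eq_zero
    · intro T hT
      obtain ⟨lam, hlam, rfl⟩ := List.mem_map.1 hT
      rw [Finset.mem_toList, Set.Finite.mem_toFinset] at hlam
      by_cases h : ∃ y, x.1.IsExtension lam y
      · obtain ⟨y, hy⟩ := h
        exact Or.inr (hgap lam hlam y hy)
      · rw [hgap0 lam (not_exists.1 h)]
        by_cases hv : v = x.1.range
        · exact Or.inl (hvert v x hF.1 hv)
        · exact Or.inr (hvert0 v x hF.1 hv)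
    · by_cases hv : v = x.1.range
      · obtain ⟨lam, hlam, h1, h2⟩ := x.2 0 (by simp) E hE (by
          rw [hv] at hF
          exact hF)
        rw [zero_add] at h1 h2
        obtain ⟨y, hy⟩ := GMor.exists_isExtension_of_init h1 h2
        refine ⟨_, List.mem_map.2 ⟨lam, ?_, rfl⟩, hgap lam hlam y hy⟩
        rwa [Finset.mem_toList, Set.Finite.mem_toFinset]
      · obtain ⟨lam, hlam⟩ := hne
        refine ⟨_, List.mem_map.2 ⟨lam, ?_, rfl⟩, ?_⟩
        · rwa [Finset.mem_toList, Set.Finite.mem_toFinset]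
        · rw [hgap0 lam fun y hy => hv (hrange lam hlam y hy), hvert0 v x hF.1 hv]
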